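/- arXiv:2305.13422 — 2 statements merged into one kernel-verified Lean document; each statement's English description precedes it below -/
import Mathlib

section
/- For all positive integers l and k, there is a colouring of the edges of the complete graph on vertex set {1, …, l^{k-1}} that contains no l-flash and no k-rainbow; consequently f(l,k) ≥ l^{k-1}. -/
/-- `r` is a tournament relation on `Fin n`: an orientation of the complete graph,
i.e. irreflexive and, for distinct vertices, exactly one direction is present. -/
def IsTournament {n : ℕ} (r : Fin n → Fin n → Prop) : Prop :=
  (∀ v, ¬ r v v) ∧ ∀ u v : Fin n, u ≠ v → (r u v ↔ ¬ r v u)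

/-- `x` is a directed walk (of length `m`) in the digraph `r`;
vertices and edges may repeat. -/
def IsWalk {n m : ℕ} (r : Fin n → Fin n → Prop) (x : Fin (m + 1) → Fin n) : Prop :=
  ∀ i : Fin m, r (x i.castSucc) (x i.succ)

/-- The sequence of colours along a sequence of `m + 1` vertices. -/
def walkColours {n m : ℕ} {α : Type} (c : Fin n → Fin n → α) (x : Fin (m + 1) → Fin n) :
    Fin m → α :=
  fun i => c (x i.castSucc) (x i.succ)

/-- The edge-coloured digraph `(r, c)` contains an `l`-flash: a directed walk of
length `l` all of whose edges have the same colour. -/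
def HasFlash {n : ℕ} {α : Type} (l : ℕ) (r : Fin n → Fin n → Prop)
    (c : Fin n → Fin n → α) : Prop :=
  ∃ x : Fin (l + 1) → Fin n, IsWalk r x ∧
    ∀ i j : Fin l, walkColours c x i = walkColours c x j

/-- The edge-coloured digraph `(r, c)` contains a `k`-rainbow: a directed walk of
length `k` whose edge colours are pairwise distinct. -/
def HasRainbow {n : ℕ} {α : Type} (k : ℕ) (r : Fin n → Fin n → Prop)
    (c : Fin n → Fin n → α) : Prop :=
  ∃ y : Fin (k + 1) → Fin n, IsWalk r y ∧ Function.Injective (walkColours c y)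

/-- The set of `m` such that every edge colouring of any tournament with more than `m`
vertices contains an `l`-flash or a `k`-rainbow. -/
def tSet (l k : ℕ) : Set ℕ :=
  {m | ∀ n : ℕ, n > m → ∀ r : Fin n → Fin n → Prop, IsTournament r →
    ∀ (α : Type) (c : Fin n → Fin n → α), HasFlash l r c ∨ HasRainbow k r c}

/-- `t l k` is the smallest integer such that every edge colouring of any tournament
with more than `t l k` vertices contains an `l`-flash or a `k`-rainbow. -/
noncomputable def t (l k : ℕ) : ℕ := sInf (tSet l k)
/-- The edge colouring `c` of the complete graph on `Fin n` contains a monotone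
`l`-flash: vertices `x 0 < x 1 < ⋯ < x l` whose consecutive edges all get the
same colour. -/
def HasMonoFlash {n : ℕ} {α : Type} (l : ℕ) (c : Fin n → Fin n → α) : Prop :=
  ∃ x : Fin (l + 1) → Fin n, StrictMono x ∧
    ∀ i j : Fin l, walkColours c x i = walkColours c x j

/-- The edge colouring `c` of the complete graph on `Fin n` contains a monotone
`k`-rainbow: vertices `y 0 < y 1 < ⋯ < y k` whose consecutive edges get pairwise
distinct colours. -/
def HasMonoRainbow {n : ℕ} {α : Type} (k : ℕ) (c : Fin n → Fin n → α) : Prop :=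
  ∃ y : Fin (k + 1) → Fin n, StrictMono y ∧ Function.Injective (walkColours c y)

/-- The set of `m` such that for every `n > m`, every colouring of the edges of the
complete graph on `n` vertices (with an arbitrary set of colours) contains a
monotone `l`-flash or a monotone `k`-rainbow. -/
def fSet (l k : ℕ) : Set ℕ :=
  {m | ∀ n : ℕ, n > m → ∀ (α : Type) (c : Fin n → Fin n → α),
    HasMonoFlash l c ∨ HasMonoRainbow k c}

/-- `f l k` is the smallest integer such that for every `n > f l k`, every colouring
of the edges of the complete graph on `n` vertices contains a monotone `l`-flash or
a monotone `k`-rainbow. -/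
noncomputable def f (l k : ℕ) : ℕ := sInf (fSet l k)
/-- The set of colours on edges directed out of `v`. -/
def outColours {n : ℕ} {α : Type} (r : Fin n → Fin n → Prop) (c : Fin n → Fin n → α)
    (v : Fin n) : Set α :=
  {a | ∃ u, r v u ∧ c v u = a}

/-- A vertex `v` is `rb`-in-robust if for every colour `a` there is an `rb`-rainbow
avoiding colour `a` that ends at `v`. -/
def IsInRobust {n : ℕ} {α : Type} (rb : ℕ) (r : Fin n → Fin n → Prop)
    (c : Fin n → Fin n → α) (v : Fin n) : Prop :=
  ∀ a : α, ∃ y : Fin (rb + 1) → Fin n, IsWalk r y ∧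
    Function.Injective (walkColours c y) ∧ (∀ i, walkColours c y i ≠ a) ∧
    y (Fin.last rb) = v

/-- The set of `m` such that every tournament with more than `m` vertices, coloured
with at most `k - 1` outgoing colours at each vertex, contains an `l`-flash, a
`k`-rainbow, or an `rb`-in-robust vertex. -/
def gSet (l k rb : ℕ) : Set ℕ :=
  {m | ∀ n : ℕ, n > m → ∀ r : Fin n → Fin n → Prop, IsTournament r →
    ∀ (α : Type) (c : Fin n → Fin n → α),
      (∀ v, (outColours r c v).ncard ≤ k - 1) →
      HasFlash l r c ∨ HasRainbow k r c ∨ ∃ v, IsInRobust rb r c v}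

/-- `g l k rb` is the smallest integer such that every tournament with more than
`g l k rb` vertices, coloured with at most `k - 1` outgoing colours at each vertex,
contains an `l`-flash, a `k`-rainbow, or an `rb`-in-robust vertex. -/
noncomputable def g (l k rb : ℕ) : ℕ := sInf (gSet l k rb)
/-- A vertex `v` is strongly `(k-2)`-robust if there is a set `C` of `k - 1` colours
containing every colour incident to `v` such that for every `a ∈ C` there is a
`(k-2)`-rainbow with colour set exactly `C \ {a}` ending at `v`, and also one
starting at `v`. -/
def IsStronglyRobust {n : ℕ} {α : Type} (k : ℕ) (r : Fin n → Fin n → Prop)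
    (c : Fin n → Fin n → α) (v : Fin n) : Prop :=
  ∃ C : Finset α, C.card = k - 1 ∧
    (∀ u : Fin n, (r u v → c u v ∈ C) ∧ (r v u → c v u ∈ C)) ∧
    ∀ a ∈ C,
      (∃ y : Fin (k - 2 + 1) → Fin n, IsWalk r y ∧
        Function.Injective (walkColours c y) ∧
        Set.range (walkColours c y) = ↑C \ {a} ∧ y (Fin.last (k - 2)) = v) ∧
      (∃ y : Fin (k - 2 + 1) → Fin n, IsWalk r y ∧
        Function.Injective (walkColours c y) ∧
        Set.range (walkColours c y) = ↑C \ {a} ∧ y 0 = v)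


namespace FlashAux

/-- Colour of an edge: the most significant base-`l` digit where the ends differ. -/
noncomputable def digitColour (l u v : ℕ) : ℕ := sInf {j | u / l ^ (j + 1) = v / l ^ (j + 1)}

lemma digitColour_lt {l k u v : ℕ} (hu : u < l ^ (k - 1)) (hv : v < l ^ (k - 1)) (h : u < v) :
    digitColour l u v < k - 1 := by
  rcases hk : k - 1 with _ | m
  · simp [hk] at hu hv; omega
  · rw [hk] at hu hv
    have : digitColour l u v ≤ m := Nat.sInf_le (by
      simp only [Set.mem_ofPred_eq]
      rw [Nat.div_eq_of_lt hu, Nat.div_eq_of_lt hv])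
    omega

lemma digit_lt {l k u v : ℕ} (hu : u < l ^ (k - 1)) (hv : v < l ^ (k - 1)) (h : u < v) :
    u / l ^ (digitColour l u v) % l < v / l ^ (digitColour l u v) % l := by
  have hmem : digitColour l u v ∈ {j | u / l ^ (j + 1) = v / l ^ (j + 1)} := by
    apply Nat.sInf_mem
    refine ⟨k - 1, ?_⟩
    simp only [Set.mem_ofPred_eq, pow_succ, ← Nat.div_div_eq_div_mul]
    rw [Nat.div_eq_of_lt hu, Nat.div_eq_of_lt hv]
  have hne : u / l ^ (digitColour l u v) ≠ v / l ^ (digitColour l u v) := by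
    intro he
    rcases hj : digitColour l u v with _ | m
    · rw [hj] at he; simp at he; omega
    · rw [hj] at he
      have : digitColour l u v ≤ m := Nat.sInf_le he
      omega
  have hle : u / l ^ (digitColour l u v) ≤ v / l ^ (digitColour l u v) :=
    Nat.div_le_div_right h.le
  simp only [Set.mem_ofPred_eq, pow_succ, ← Nat.div_div_eq_div_mul] at hmem
  generalize u / l ^ (digitColour l u v) = a at *
  generalize v / l ^ (digitColour l u v) = b at *
  have h1 := Nat.div_add_mod a l
  have h2 := Nat.div_add_mod b l
  rw [hmem] at h1
  omega

lemma lower (l k : ℕ) (hl : 0 < l) (hk : 0 < k) :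
    ∃ c : Fin (l ^ (k - 1)) → Fin (l ^ (k - 1)) → ℕ,
      ¬ HasMonoFlash l c ∧ ¬ HasMonoRainbow k c := by
  refine ⟨fun u v => digitColour l u v, ?_, ?_⟩
  · rintro ⟨x, hx, hc⟩
    have hmono : StrictMono (fun i : Fin (l + 1) =>
        (x i : ℕ) / l ^ (walkColours (fun u v => digitColour l u v) x ⟨0, hl⟩) % l) := by
      rw [Fin.strictMono_iff_lt_succ]
      intro i
      rw [hc ⟨0, hl⟩ i]
      exact digit_lt (x i.castSucc).2 (x i.succ).2 (hx i.castSucc_lt_succ)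
    have hinj : Function.Injective (fun i : Fin (l + 1) => (⟨_, Nat.mod_lt
        ((x i : ℕ) / l ^ (walkColours (fun u v => digitColour l u v) x ⟨0, hl⟩)) hl⟩ : Fin l)) := by
      intro i j hij
      exact hmono.injective (congrArg Fin.val hij)
    have := Fintype.card_le_of_injective _ hinj
    simp at this
  · rintro ⟨y, hy, hinj⟩
    have hinj' : Function.Injective (fun i : Fin k => (⟨walkColours (fun u v => digitColour l u v) y i,
        digitColour_lt (y i.castSucc).2 (y i.succ).2 (hy i.castSucc_lt_succ)⟩ : Fin (k - 1))) := by
      intro i j hij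
      exact hinj (congrArg Fin.val hij)
    have := Fintype.card_le_of_injective _ hinj'
    simp at this
    omega

lemma endHom (k m : ℕ) : ∃ M : ℕ, ∀ (n : ℕ) (α : Type) (c : Fin n → Fin n → α)
    (C : Fin n → Finset α) (S : Finset (Fin n)), (∀ v ∈ S, (C v).card ≤ k) →
    (∀ v ∈ S, ∀ w ∈ S, v < w → c v w ∈ C v) → M ≤ S.card →
    ∃ T ⊆ S, T.card = m ∧ ∃ a : Fin n → α, ∀ v ∈ T, ∀ w ∈ T, v < w → c v w = a v := by
  classical
  induction m with
  | zero =>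
    refine ⟨1, fun n α c C S _ _ hS => ⟨∅, by simp, by simp, ?_⟩⟩
    obtain ⟨v, hv⟩ := Finset.card_pos.1 hS
    exact ⟨fun _ => c v v, by simp⟩
  | succ m ih =>
    obtain ⟨M, hM⟩ := ih
    refine ⟨k * M + 2, fun n α c C S hC hc hS => ?_⟩
    have hne : S.Nonempty := Finset.card_pos.1 (by omega)
    set v := S.min' hne with hv
    have hvS : v ∈ S := S.min'_mem hne
    have hlt : ∀ w ∈ S.erase v, v < w := fun w hw =>
      lt_of_le_of_ne (S.min'_le w (Finset.mem_of_mem_erase hw)) (Finset.ne_of_mem_erase hw).symm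
    have hcard : (S.erase v).card = S.card - 1 := Finset.card_erase_of_mem hvS
    have hmaps : ∀ w ∈ S.erase v, c v w ∈ C v := fun w hw =>
      hc v hvS w (Finset.mem_of_mem_erase hw) (hlt w hw)
    obtain ⟨b, hb, hbc⟩ := Finset.exists_lt_card_fiber_of_mul_lt_card_of_maps_to
      (f := fun w => c v w) (n := M) hmaps (by
        have := Nat.mul_le_mul_right M (hC v hvS)
        omega)
    set S' := (S.erase v).filter (fun w => c v w = b) with hS'
    have hsub : S' ⊆ S.erase v := Finset.filter_subset _ _
    have hsub2 : S' ⊆ S := hsub.trans (Finset.erase_subset _ _)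
    obtain ⟨T, hT, hTc, a, ha⟩ := hM n α c C S' (fun w hw => hC w (hsub2 hw))
      (fun w hw z hz => hc w (hsub2 hw) z (hsub2 hz)) hbc.le
    have hvT : v ∉ T := fun h => (Finset.notMem_erase v S) (hsub (hT h))
    refine ⟨insert v T, ?_, by simp [hvT, hTc], Function.update a v b, ?_⟩
    · exact Finset.insert_subset hvS (hT.trans hsub2)
    · intro x hx y hy hxy
      rw [Finset.mem_insert] at hx hy
      rcases hx with rfl | hx
      · rcases hy with rfl | hy
        · exact absurd hxy (lt_irrefl _)
        · rw [Function.update_self]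
          exact (Finset.mem_filter.1 (hT hy)).2
      · have hxv : x ≠ v := fun h => hvT (h ▸ hx)
        rw [Function.update_of_ne hxv]
        rcases hy with rfl | hy
        · exact absurd hxy (hlt x (hsub (hT hx))).not_gt
        · exact ha x hx y hy hxy

lemma ofEndHom {l k n : ℕ} {α : Type} {c : Fin n → Fin n → α} {T : Finset (Fin n)}
    {a : Fin n → α} (ha : ∀ v ∈ T, ∀ w ∈ T, v < w → c v w = a v) (hT : k * l < T.card) :
    HasMonoFlash l c ∨ HasMonoRainbow k c := by
  classical
  have key : ∀ (m : ℕ) (U : Finset (Fin n)) (hU : U.card = m + 1), U ⊆ T → ∀ i : Fin m,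
      walkColours c (U.orderEmbOfFin hU) i = a (U.orderEmbOfFin hU i.castSucc) := by
    intro m U hU hUT i
    exact ha _ (hUT (U.orderEmbOfFin_mem hU _)) _ (hUT (U.orderEmbOfFin_mem hU _))
      ((U.orderEmbOfFin hU).strictMono i.castSucc_lt_succ)
  by_cases h : (T.image a).card ≤ k
  · left
    obtain ⟨b, hb, hbc⟩ := Finset.exists_lt_card_fiber_of_mul_lt_card_of_maps_to
      (s := T) (t := T.image a) (f := a) (n := l) (fun w hw => Finset.mem_image_of_mem a hw)
      (lt_of_le_of_lt (Nat.mul_le_mul_right l h) hT)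
    obtain ⟨U, hUs, hU⟩ := Finset.exists_subset_card_eq (Nat.succ_le_of_lt hbc)
    have hUT : U ⊆ T := hUs.trans (Finset.filter_subset _ _)
    refine ⟨U.orderEmbOfFin hU, (U.orderEmbOfFin hU).strictMono, fun i j => ?_⟩
    rw [key l U hU hUT, key l U hU hUT]
    rw [(Finset.mem_filter.1 (hUs (U.orderEmbOfFin_mem hU i.castSucc))).2,
      (Finset.mem_filter.1 (hUs (U.orderEmbOfFin_mem hU j.castSucc))).2]
  · right
    obtain ⟨I, hI, hIc⟩ := Finset.exists_subset_card_eq (Nat.succ_le_of_lt (not_le.1 h))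
    obtain ⟨U, hUT, hUI, hinj⟩ : ∃ U ⊆ T, U.image a = I ∧ Set.InjOn a U := by
      have hch : ∀ b : I, ∃ v ∈ T, a v = b := fun b => Finset.mem_image.1 (hI b.2)
      choose p hpT hpa using hch
      refine ⟨Finset.univ.image p, ?_, ?_, ?_⟩
      · intro v hv
        obtain ⟨b, -, rfl⟩ := Finset.mem_image.1 hv
        exact hpT b
      · ext b
        simp only [Finset.mem_image, Finset.mem_univ, true_and, exists_exists_eq_and, hpa]
        exact ⟨fun ⟨b', h⟩ => h ▸ b'.2, fun h => ⟨⟨b, h⟩, rfl⟩⟩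
      · intro v hv w hw hvw
        simp only [Finset.coe_image, Set.mem_image] at hv hw
        obtain ⟨b, -, rfl⟩ := hv
        obtain ⟨b', -, rfl⟩ := hw
        rw [hpa, hpa] at hvw
        rw [Subtype.ext hvw]
    have hU : U.card = k + 1 := by rw [← Finset.card_image_of_injOn hinj, hUI, hIc]
    refine ⟨U.orderEmbOfFin hU, (U.orderEmbOfFin hU).strictMono, fun i j hij => ?_⟩
    rw [key k U hU hUT, key k U hU hUT] at hij
    have := hinj (U.orderEmbOfFin_mem hU _) (U.orderEmbOfFin_mem hU _) hij
    exact Fin.castSucc_injective _ ((U.orderEmbOfFin hU).injective this)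

/-- A monotone `k`-rainbow inside `S` ending at `v`. -/
def EndsAt {n : ℕ} {α : Type} (c : Fin n → Fin n → α) (S : Finset (Fin n)) (k : ℕ)
    (v : Fin n) (y : Fin (k + 1) → Fin n) : Prop :=
  StrictMono y ∧ (∀ i, y i ∈ S) ∧ y (Fin.last k) = v ∧ Function.Injective (walkColours c y)

lemma EndsAt.snoc {n : ℕ} {α : Type} {c : Fin n → Fin n → α} {S : Finset (Fin n)} {k : ℕ}
    {v w : Fin n} {y : Fin (k + 1) → Fin n} (h : EndsAt c S k v y) (hw : w ∈ S) (hvw : v < w)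
    (hc : ∀ i, walkColours c y i ≠ c v w) :
    EndsAt c S (k + 1) w (Fin.snoc (α := fun _ => Fin n) y w) := by
  obtain ⟨h1, h2, rfl, h4⟩ := h
  have e1 : ∀ i : Fin k, walkColours c (Fin.snoc (α := fun _ => Fin n) y w) i.castSucc
      = walkColours c y i := by
    intro i
    simp only [walkColours, Fin.snoc_castSucc, Fin.succ_castSucc]
  have e2 : walkColours c (Fin.snoc (α := fun _ => Fin n) y w) (Fin.last k)
      = c (y (Fin.last k)) w := by
    simp only [walkColours, Fin.snoc_castSucc, Fin.succ_last, Fin.snoc_last]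
  refine ⟨?_, ?_, by simp, ?_⟩
  · rw [Fin.strictMono_iff_lt_succ]
    intro i
    induction i using Fin.lastCases with
    | last => simpa only [Fin.snoc_castSucc, Fin.succ_last, Fin.snoc_last] using hvw
    | cast i =>
      simp only [Fin.snoc_castSucc, Fin.succ_castSucc]
      exact h1 i.castSucc_lt_succ
  · intro i
    induction i using Fin.lastCases with
    | last => simpa using hw
    | cast i => simpa using h2 i
  · intro i j hij
    induction i using Fin.lastCases with
    | last =>
      induction j using Fin.lastCases with
      | last => rfl
      | cast j => rw [e1, e2] at hij; exact absurd hij.symm (hc j)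
    | cast i =>
      induction j using Fin.lastCases with
      | last => rw [e1, e2] at hij; exact absurd hij (hc i)
      | cast j => rw [e1, e1] at hij; rw [h4 hij]

lemma EndsAt.mono {n : ℕ} {α : Type} {c : Fin n → Fin n → α} {S S' : Finset (Fin n)} {k : ℕ}
    {v : Fin n} {y : Fin (k + 1) → Fin n} (h : EndsAt c S k v y) (hS : S ⊆ S') :
    EndsAt c S' k v y := ⟨h.1, fun i => hS (h.2.1 i), h.2.2⟩

lemma upper (l K k : ℕ) (hkK : k ≤ K) : ∃ N : ℕ, ∀ (n : ℕ) (α : Type) (c : Fin n → Fin n → α)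
    (S : Finset (Fin n)), N ≤ S.card → HasMonoFlash l c ∨ HasMonoRainbow K c ∨
      ∃ v y, EndsAt c S k v y := by
  classical
  induction k with
  | zero =>
    refine ⟨1, fun n α c S hS => ?_⟩
    obtain ⟨v, hv⟩ := Finset.card_pos.1 hS
    refine Or.inr (Or.inr ⟨v, fun _ => v, ?_, fun _ => hv, rfl, fun i => i.elim0⟩)
    intro i j hij
    have := i.2
    have := j.2
    have := Fin.lt_def.1 hij
    omega
  | succ k ih =>
    obtain ⟨N, hN⟩ := ih (by omega)
    obtain ⟨M, hM⟩ := endHom k (K * l + 1)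
    refine ⟨N + M, fun n α c S hS => ?_⟩
    by_contra! hcon
    obtain ⟨hf, hr, hno⟩ := hcon
    set B := S.filter (fun v => ∃ y, EndsAt c S k v y) with hB
    have hBS : B ⊆ S := Finset.filter_subset _ _
    have hsmall : (S \ B).card < N := by
      by_contra! hge
      rcases hN n α c (S \ B) hge with h | h | ⟨v, y, h⟩
      · exact hf h
      · exact hr h
      · have hv : v ∈ S \ B := by
          have := h.2.1 (Fin.last k)
          rwa [h.2.2.1] at this
        rw [Finset.mem_sdiff] at hv
        exact hv.2 (Finset.mem_filter.2 ⟨hv.1, y, h.mono Finset.sdiff_subset⟩)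
    have hBc : M ≤ B.card := by
      have := Finset.card_sdiff_add_card_eq_card hBS
      omega
    have hex : ∀ v : Fin n, ∃ C : Finset α, v ∈ B → C.card ≤ k ∧ ∀ w ∈ S, v < w → c v w ∈ C := by
      intro v
      by_cases hv : v ∈ B
      · obtain ⟨hvS, y, hy⟩ := Finset.mem_filter.1 hv
        refine ⟨Finset.univ.image (walkColours c y), fun _ => ⟨?_, ?_⟩⟩
        · exact Finset.card_image_le.trans (by simp)
        · intro w hw hvw
          by_contra hmem
          refine hno w _ (hy.snoc hw hvw fun i hi => hmem ?_)
          rw [← hi]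
          exact Finset.mem_image_of_mem _ (Finset.mem_univ i)
      · exact ⟨∅, fun h => absurd h hv⟩
    choose C hC using hex
    obtain ⟨T, hT, hTc, a, ha⟩ := hM n α c C B (fun v hv => (hC v hv).1)
      (fun v hv w hw => (hC v hv).2 w (hBS hw)) hBc
    rcases ofEndHom (l := l) (k := K) ha (by omega) with h | h
    · exact hf h
    · exact hr h

lemma fSet_nonempty (l k : ℕ) : (fSet l k).Nonempty := by
  obtain ⟨N, hN⟩ := upper l k k le_rfl
  refine ⟨N, fun n hn α c => ?_⟩
  rcases hN n α c Finset.univ (by simp; omega) with h | h | ⟨v, y, h⟩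
  · exact Or.inl h
  · exact Or.inr h
  · exact Or.inr ⟨y, h.1, h.2.2.2⟩

end FlashAux

/-- For all positive integers l and k there is a colouring of the edges of the
complete graph on l^{k-1} vertices with no monotone l-flash and no monotone
k-rainbow; consequently f(l,k) ≥ l^{k-1}. -/
theorem f_lower_bound (l k : ℕ) (hl : 0 < l) (hk : 0 < k) :
    (∃ c : Fin (l ^ (k - 1)) → Fin (l ^ (k - 1)) → ℕ,
      ¬ HasMonoFlash l c ∧ ¬ HasMonoRainbow k c) ∧
    l ^ (k - 1) ≤ f l k := by
  have hlow := FlashAux.lower l k hl hk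
  refine ⟨hlow, ?_⟩
  by_contra! hlt
  obtain ⟨c, h1, h2⟩ := hlow
  rcases Nat.sInf_mem (FlashAux.fSet_nonempty l k) _ hlt ℕ c with h | h
  · exact h1 h
  · exact h2 h
end

section
/- For all positive integers l and all integers k ≥ 2, t(l,k) ≤ 2 · t(l,k-1) + (l + 2√l)^{k-1}. -/
open Finset in
theorem core_count {V β S : Type} [Fintype β] [DecidableEq β] [Fintype S] [DecidableEq S]
    (W : Finset V) (C D : V → Finset β) (σ : V → β → S) (w : S → ℝ) (p : ℝ) (k : ℕ)
    (hp0 : 0 < p) (hp1 : p ≤ 1) (hw : ∀ s, p ^ 2 ≤ w s) (hsum : ∑ s, w s = 1)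
    (hC : ∀ v ∈ W, #(C v) ≤ k) (hD : ∀ v ∈ W, #(D v) ≤ k)
    (h1 : ∀ v ∈ W, ∀ b ∈ C v, b ∉ D v → p ≤ w (σ v b))
    (h2 : ∀ v ∈ W, ∀ b ∈ D v, b ∉ C v → p ≤ w (σ v b))
    (hsep : ∀ u ∈ W, ∀ v ∈ W, u ≠ v → ∃ b, (b ∈ C u ∨ b ∈ D u) ∧ (b ∈ C v ∨ b ∈ D v) ∧
      σ u b ≠ σ v b) :
    (#W : ℝ) * (p ^ 2) ^ k ≤ 1 := by
  classical
  have hw0 : ∀ s, 0 ≤ w s := fun s => (by positivity : (0:ℝ) ≤ p ^ 2).trans (hw s)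
  let A : V → β → Finset S := fun v b => if b ∈ C v ∨ b ∈ D v then {σ v b} else univ
  let E : V → Finset (β → S) := fun v => Fintype.piFinset (A v)
  let wt : (β → S) → ℝ := fun X => ∏ b, w (X b)
  have hE : ∀ v ∈ W, (p ^ 2) ^ k ≤ ∑ X ∈ E v, wt X := by
    intro v hv
    have e1 : ∑ X ∈ E v, wt X = ∏ b, ∑ s ∈ A v b, w s := (Finset.prod_univ_sum _ _).symm
    rw [e1]
    have e2 : ∏ b, ((if b ∈ C v then p else 1) * (if b ∈ D v then p else 1)) ≤
        ∏ b, ∑ s ∈ A v b, w s := by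
      apply Finset.prod_le_prod
      · intro b _
        split_ifs <;> positivity
      · intro b _
        by_cases hc : b ∈ C v <;> by_cases hd : b ∈ D v
        · simp only [A, hc, hd, if_true, true_or, sum_singleton]
          have := hw (σ v b); nlinarith
        · simp only [A, hc, hd, if_true, if_false, true_or, sum_singleton]
          have := h1 v hv b hc hd; linarith
        · simp only [A, hc, hd, if_true, if_false, or_true, sum_singleton]
          have := h2 v hv b hd hc; linarith
        · simp [A, hc, hd, hsum]
    refine le_trans ?_ e2
    rw [Finset.prod_mul_distrib, Finset.prod_ite_mem, Finset.prod_ite_mem]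
    simp only [univ_inter, prod_const]
    rw [← pow_mul, mul_comm 2 k, mul_two, pow_add]
    have a1 := pow_le_pow_of_le_one hp0.le hp1 (hC v hv)
    have a2 := pow_le_pow_of_le_one hp0.le hp1 (hD v hv)
    exact mul_le_mul a1 a2 (by positivity) (by positivity)
  have hdis : (W : Set V).PairwiseDisjoint E := by
    intro u hu v hv huv
    obtain ⟨b, hb1, hb2, hb3⟩ := hsep u hu v hv huv
    rw [Function.onFun, Finset.disjoint_left]
    intro X hX hY
    have x1 := Fintype.mem_piFinset.1 hX b
    have x2 := Fintype.mem_piFinset.1 hY b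
    simp only [A, hb1, hb2, if_true, mem_singleton] at x1 x2
    exact hb3 (x1.symm.trans x2)
  calc (#W : ℝ) * (p ^ 2) ^ k = ∑ v ∈ W, (p ^ 2) ^ k := by simp
    _ ≤ ∑ v ∈ W, ∑ X ∈ E v, wt X := Finset.sum_le_sum hE
    _ = ∑ X ∈ W.biUnion E, wt X := (Finset.sum_biUnion hdis).symm
    _ ≤ ∑ X, wt X := Finset.sum_le_sum_of_subset_of_nonneg (subset_univ _)
        (fun X _ _ => Finset.prod_nonneg fun b _ => hw0 _)
    _ = ∏ b : β, ∑ s, w s := by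
        rw [Finset.prod_univ_sum]; simp [wt, Fintype.piFinset_univ]
    _ = 1 := by simp [hsum]

/-- appending a vertex -/
theorem snoc_walk {n m : ℕ} {α : Type} {r : Fin n → Fin n → Prop} (c : Fin n → Fin n → α)
    {x : Fin (m + 1) → Fin n} (hx : IsWalk r x) {v : Fin n} (h : r (x (Fin.last m)) v) :
    ∃ y : Fin (m + 1 + 1) → Fin n, IsWalk r y ∧ y (Fin.last (m + 1)) = v ∧
      (∀ i : Fin m, walkColours c y i.castSucc = walkColours c x i) ∧
      walkColours c y (Fin.last m) = c (x (Fin.last m)) v := by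
  refine ⟨Fin.snoc (α := fun _ => Fin n) x v, ?_, by simp, ?_, ?_⟩
  · intro i
    refine Fin.lastCases ?_ (fun j => ?_) i
    · rw [Fin.snoc_castSucc, Fin.succ_last, Fin.snoc_last]; exact h
    · rw [Fin.snoc_castSucc, Fin.succ_castSucc, Fin.snoc_castSucc]; exact hx j
  · intro i
    simp only [walkColours]
    rw [Fin.snoc_castSucc, Fin.succ_castSucc, Fin.snoc_castSucc]
  · simp only [walkColours]
    rw [Fin.snoc_castSucc, Fin.succ_last, Fin.snoc_last]

/-- prepending a vertex -/
theorem cons_walk {n m : ℕ} {α : Type} {r : Fin n → Fin n → Prop} (c : Fin n → Fin n → α)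
    {x : Fin (m + 1) → Fin n} (hx : IsWalk r x) {v : Fin n} (h : r v (x 0)) :
    ∃ y : Fin (m + 1 + 1) → Fin n, IsWalk r y ∧
      (∀ i : Fin m, walkColours c y i.succ = walkColours c x i) ∧
      walkColours c y 0 = c v (x 0) := by
  refine ⟨Fin.cons (α := fun _ => Fin n) v x, ?_, ?_, ?_⟩
  · intro i
    refine Fin.cases ?_ (fun j => ?_) i
    · simpa using h
    · rw [Fin.cons_succ, ← Fin.succ_castSucc, Fin.cons_succ]; exact hx j
  · intro i
    simp only [walkColours]
    rw [Fin.cons_succ, ← Fin.succ_castSucc, Fin.cons_succ]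
  · simp [walkColours]

theorem snoc_rainbow {n m : ℕ} {α : Type} {r : Fin n → Fin n → Prop} {c : Fin n → Fin n → α}
    {x : Fin (m + 1) → Fin n} (hx : IsWalk r x) (hi : Function.Injective (walkColours c x))
    {v : Fin n} (h : r (x (Fin.last m)) v)
    (hn : c (x (Fin.last m)) v ∉ Set.range (walkColours c x)) : HasRainbow (m + 1) r c := by
  obtain ⟨y, hy, -, h1, h2⟩ := snoc_walk c hx h
  refine ⟨y, hy, ?_⟩
  intro i j
  refine Fin.lastCases ?_ (fun i => ?_) i <;> refine Fin.lastCases ?_ (fun j => ?_) j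
  · simp
  · rw [h1, h2]; intro e; exact absurd ⟨j, e.symm⟩ hn
  · rw [h1, h2]; intro e; exact absurd ⟨i, e⟩ hn
  · rw [h1, h1]; intro e; rw [hi e]

theorem cons_rainbow {n m : ℕ} {α : Type} {r : Fin n → Fin n → Prop} {c : Fin n → Fin n → α}
    {x : Fin (m + 1) → Fin n} (hx : IsWalk r x) (hi : Function.Injective (walkColours c x))
    {v : Fin n} (h : r v (x 0))
    (hn : c v (x 0) ∉ Set.range (walkColours c x)) : HasRainbow (m + 1) r c := by
  obtain ⟨y, hy, h1, h2⟩ := cons_walk c hx h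
  refine ⟨y, hy, ?_⟩
  intro i j
  refine Fin.cases ?_ (fun i => ?_) i <;> refine Fin.cases ?_ (fun j => ?_) j
  · simp
  · rw [h1, h2]; intro e; exact absurd ⟨j, e.symm⟩ hn
  · rw [h1, h2]; intro e; exact absurd ⟨i, e⟩ hn
  · rw [h1, h1]; intro e; rw [hi e]

/-- there is a monochromatic walk of colour `b` and length `m` ending at `v` -/
def MonoEnd {n : ℕ} {α : Type} (r : Fin n → Fin n → Prop) (c : Fin n → Fin n → α) (b : α) :
    ℕ → Fin n → Prop
  | 0, _ => True
  | m + 1, v => ∃ u, r u v ∧ c u v = b ∧ MonoEnd r c b m u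

theorem MonoEnd.walk {n : ℕ} {α : Type} {r : Fin n → Fin n → Prop} {c : Fin n → Fin n → α}
    {b : α} : ∀ (m : ℕ) (v : Fin n), MonoEnd r c b m v → ∃ x : Fin (m + 1) → Fin n,
      IsWalk r x ∧ x (Fin.last m) = v ∧ ∀ i, walkColours c x i = b
  | 0, v, _ => ⟨fun _ => v, fun i => i.elim0, rfl, fun i => i.elim0⟩
  | m + 1, v, ⟨u, hu, hc, h⟩ => by
    obtain ⟨x, hx, hl, hxc⟩ := MonoEnd.walk m u h
    subst hl
    obtain ⟨y, hy, h0, h1, h2⟩ := snoc_walk c hx hu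
    refine ⟨y, hy, h0, fun i => ?_⟩
    refine Fin.lastCases ?_ (fun i => ?_) i
    · rw [h2, hc]
    · rw [h1, hxc]

/-- passing to a large vertex subset -/
theorem sub_tournament {l k m n : ℕ} (hm : m ∈ tSet l k) {r : Fin n → Fin n → Prop}
    (hr : IsTournament r) {α : Type} (c : Fin n → Fin n → α) (U : Finset (Fin n))
    (hU : m < U.card) (hnf : ¬ HasFlash l r c) :
    ∃ y : Fin (k + 1) → Fin n, IsWalk r y ∧ Function.Injective (walkColours c y) ∧
      ∀ i, y i ∈ U := by
  let e := U.orderEmbOfFin rfl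
  have ht : IsTournament (fun a b => r (e a) (e b)) :=
    ⟨fun v => hr.1 _, fun u v h => hr.2 _ _ (fun h' => h (e.injective h'))⟩
  rcases hm _ hU _ ht α (fun a b => c (e a) (e b)) with ⟨x, hx, h⟩ | ⟨x, hx, h⟩
  · exact absurd ⟨fun i => e (x i), hx, h⟩ hnf
  · exact ⟨fun i => e (x i), hx, h, fun i => Finset.orderEmbOfFin_mem _ _ _⟩

open Finset in
theorem step_finite {l k m n : ℕ} (hl : 2 ≤ l) (hm : m ∈ tSet l k) {r : Fin n → Fin n → Prop}
    (hr : IsTournament r) {α : Type} [Fintype α] (c : Fin n → Fin n → α)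
    (hnf : ¬ HasFlash l r c) (hnr : ¬ HasRainbow (k + 1) r c) :
    (n : ℝ) ≤ 2 * m + ((l : ℝ) + 2 * Real.sqrt l) ^ k := by
  classical
  let P : Fin n → Prop := fun v => ∃ y : Fin (k + 1) → Fin n, IsWalk r y ∧
    Function.Injective (walkColours c y) ∧ y (Fin.last k) = v
  let Q : Fin n → Prop := fun v => ∃ y : Fin (k + 1) → Fin n, IsWalk r y ∧
    Function.Injective (walkColours c y) ∧ y 0 = v
  have hP : #{v | ¬ P v} ≤ m := by
    by_contra! h
    obtain ⟨y, h1, h2, h3⟩ := sub_tournament hm hr c _ h hnf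
    exact (mem_filter.1 (h3 (Fin.last k))).2 ⟨y, h1, h2, rfl⟩
  have hQ : #{v | ¬ Q v} ≤ m := by
    by_contra! h
    obtain ⟨y, h1, h2, h3⟩ := sub_tournament hm hr c _ h hnf
    exact (mem_filter.1 (h3 0)).2 ⟨y, h1, h2, rfl⟩
  let W : Finset (Fin n) := {v | P v ∧ Q v}
  have hn : n ≤ m + m + #W := by
    have : (univ : Finset (Fin n)) ⊆ (({v | ¬ P v} : Finset (Fin n)) ∪ ({v | ¬ Q v} : Finset (Fin n))) ∪ W := by
      intro v _
      simp only [W, mem_union, mem_filter, mem_univ, true_and]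
      tauto
    have h1 := card_le_card this
    rw [card_univ, Fintype.card_fin] at h1
    have h2 := card_union_le (({v | ¬ P v} : Finset (Fin n)) ∪ ({v | ¬ Q v} : Finset (Fin n))) W
    have h3 := card_union_le ({v | ¬ P v} : Finset (Fin n)) {v | ¬ Q v}
    omega
  let C : Fin n → Finset α := fun v => {b | ∃ u, r v u ∧ c v u = b}
  let D : Fin n → Finset α := fun v => {b | ∃ u, r u v ∧ c u v = b}
  have hcard : ∀ y : Fin (k + 1) → Fin n, #(univ.image (walkColours c y)) ≤ k := fun y =>
    card_image_le.trans (by simp)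
  have hC : ∀ v ∈ W, #(C v) ≤ k := by
    intro v hv
    obtain ⟨y, hy, hi, rfl⟩ := (mem_filter.1 hv).2.1
    refine (card_le_card ?_).trans (hcard y)
    intro b hb
    obtain ⟨u, hu, rfl⟩ := (mem_filter.1 hb).2
    by_contra hcon
    exact hnr (snoc_rainbow hy hi hu (by simpa using hcon))
  have hD : ∀ v ∈ W, #(D v) ≤ k := by
    intro v hv
    obtain ⟨y, hy, hi, rfl⟩ := (mem_filter.1 hv).2.2
    refine (card_le_card ?_).trans (hcard y)
    intro b hb
    obtain ⟨u, hu, rfl⟩ := (mem_filter.1 hb).2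
    by_contra hcon
    exact hnr (cons_rainbow hy hi hu (by simpa using hcon))
  -- longest monochromatic walks
  have hno : ∀ b v, ¬ MonoEnd r c b l v := by
    intro b v h
    obtain ⟨x, hx, -, h'⟩ := MonoEnd.walk l v h
    exact hnf ⟨x, hx, fun i j => (h' i).trans (h' j).symm⟩
  let a : α → Fin n → ℕ := fun b v => Nat.findGreatest (fun j => MonoEnd r c b j v) l
  have ha : ∀ b v, MonoEnd r c b (a b v) v := fun b v =>
    Nat.findGreatest_spec (P := fun j => MonoEnd r c b j v) (Nat.zero_le l) trivial
  have hal : ∀ b v, a b v < l := fun b v => by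
    refine lt_of_le_of_ne (Nat.findGreatest_le l) (fun h => hno b v ?_)
    have := ha b v
    rwa [h] at this
  have hstep : ∀ u v, r u v → a (c u v) u < a (c u v) v := by
    intro u v h
    exact Nat.le_findGreatest (P := fun j => MonoEnd r c (c u v) j v) (hal _ _)
      ⟨u, h, rfl, ha _ _⟩
  let σ : Fin n → α → Fin l := fun v b =>
    if b ∈ C v then if b ∈ D v then ⟨a b v, hal b v⟩ else ⟨0, by omega⟩ else ⟨l - 1, by omega⟩
  have hlt : ∀ u v, r u v → σ u (c u v) < σ v (c u v) := by
    intro u v h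
    have h1 : c u v ∈ C u := mem_filter.2 ⟨mem_univ _, v, h, rfl⟩
    have h2 : c u v ∈ D v := mem_filter.2 ⟨mem_univ _, u, h, rfl⟩
    have h3 := hstep u v h
    have h5 : c u v ∈ C v → a (c u v) v < l - 1 := by
      intro hc
      obtain ⟨x, hx, hxc⟩ := (mem_filter.1 hc).2
      have := hstep v x hx
      rw [hxc] at this
      have := hal (c u v) x
      omega
    have h4 := hal (c u v) v
    by_cases q1 : c u v ∈ D u <;> by_cases q2 : c u v ∈ C v <;>
      simp only [σ, h1, h2, q1, q2, if_true, if_false, Fin.mk_lt_mk] <;> omega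
  -- weights
  let N : ℝ := (1 + Real.sqrt (l - 1)) ^ 2
  let p : ℝ := (1 + Real.sqrt (l - 1))⁻¹
  have hs0 : 0 ≤ Real.sqrt ((l : ℝ) - 1) := Real.sqrt_nonneg _
  have hl2 : (2 : ℝ) ≤ l := by exact_mod_cast hl
  have hs2 : Real.sqrt ((l : ℝ) - 1) ^ 2 = l - 1 := Real.sq_sqrt (by linarith)
  have hp0 : 0 < p := by positivity
  have hp1 : p ≤ 1 := inv_le_one_of_one_le₀ (by linarith)
  let w : Fin l → ℝ := fun s => if s.1 = 0 ∨ s.1 = l - 1 then p else p ^ 2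
  have hw : ∀ s, p ^ 2 ≤ w s := by
    intro s
    simp only [w]
    split_ifs
    · nlinarith
    · exact le_rfl
  have hsum : ∑ s, w s = 1 := by
    obtain ⟨L, rfl⟩ : ∃ L, l = L + 2 := ⟨l - 2, by omega⟩
    rw [Fin.sum_univ_succ, Fin.sum_univ_castSucc]
    have e0 : w 0 = p := by simp [w]
    have e1 : w (Fin.last L).succ = p := by simp [w]
    have e2 : ∀ i : Fin L, w i.castSucc.succ = p ^ 2 := by
      intro i
      have := i.2
      simp only [w, Fin.val_succ, Fin.val_castSucc]
      rw [if_neg (by omega)]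
    simp only [e0, e1, e2, sum_const, card_univ, Fintype.card_fin, nsmul_eq_mul]
    push_cast at hs2 hs0 ⊢
    simp only [p]
    push_cast
    field_simp
    nlinarith
  have key := core_count W C D σ w p k hp0 hp1 hw hsum hC hD
    (by
      intro v _ b hb hb'
      simp [σ, w, hb, hb'])
    (by
      intro v _ b hb hb'
      simp [σ, w, hb'])
    (by
      intro u _ v _ huv
      by_cases h : r u v
      · exact ⟨c u v, Or.inl (mem_filter.2 ⟨mem_univ _, v, h, rfl⟩),
          Or.inr (mem_filter.2 ⟨mem_univ _, u, h, rfl⟩), (hlt u v h).ne⟩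
      · have h : r v u := (hr.2 v u huv.symm).2 h
        exact ⟨c v u, Or.inr (mem_filter.2 ⟨mem_univ _, v, h, rfl⟩),
          Or.inl (mem_filter.2 ⟨mem_univ _, u, h, rfl⟩), (hlt v u h).ne'⟩)
  have hN0 : 0 < N := by positivity
  have hpN : p ^ 2 = N⁻¹ := by simp [p, N]
  rw [hpN, inv_pow, ← div_eq_mul_inv, div_le_one (by positivity)] at key
  have hNl : N ≤ (l : ℝ) + 2 * Real.sqrt l := by
    have : Real.sqrt ((l : ℝ) - 1) ≤ Real.sqrt l := Real.sqrt_le_sqrt (by linarith)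
    simp only [N]; nlinarith
  have hpow := pow_le_pow_left₀ hN0.le hNl k
  have hn' : (n : ℝ) ≤ m + m + #W := by exact_mod_cast hn
  linarith

theorem step_general {l k m n : ℕ} (hl : 0 < l) (hm : m ∈ tSet l k) {r : Fin n → Fin n → Prop}
    (hr : IsTournament r) {α : Type} (c : Fin n → Fin n → α)
    (hnf : ¬ HasFlash l r c) (hnr : ¬ HasRainbow (k + 1) r c) :
    (n : ℝ) ≤ 2 * m + ((l : ℝ) + 2 * Real.sqrt l) ^ k := by
  have hl1 : (1 : ℝ) ≤ l := by exact_mod_cast hl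
  rcases Nat.lt_or_ge l 2 with h2 | h2
  · obtain rfl : l = 1 := by omega
    have hn : n ≤ 1 := by
      by_contra! hn
      let u : Fin n := ⟨0, by omega⟩
      let v : Fin n := ⟨1, hn⟩
      have huv : u ≠ v := by simp [u, v]
      have : ∃ x y, r x y := by
        by_cases h : r u v
        · exact ⟨u, v, h⟩
        · exact ⟨v, u, (hr.2 v u huv.symm).2 h⟩
      obtain ⟨x, y, hxy⟩ := this
      refine hnf ⟨![x, y], ?_, ?_⟩
      · intro i; fin_cases i; simpa using hxy
      · intro i j; rw [Subsingleton.elim i j]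
    have hn' : (n : ℝ) ≤ 1 := by exact_mod_cast hn
    have : (1 : ℝ) ≤ (((1 : ℕ) : ℝ) + 2 * Real.sqrt ((1 : ℕ) : ℝ)) ^ k :=
      one_le_pow₀ (by have := Real.sqrt_nonneg ((1 : ℕ) : ℝ); linarith)
    have : (0 : ℝ) ≤ m := by positivity
    linarith
  · let β := Set.range (fun q : Fin n × Fin n => c q.1 q.2)
    have : Fintype β := Fintype.ofFinite _
    let c' : Fin n → Fin n → β := fun u v => ⟨c u v, (u, v), rfl⟩
    refine step_finite h2 hm hr c' ?_ ?_
    · rintro ⟨x, hx, h⟩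
      exact hnf ⟨x, hx, fun i j => congrArg Subtype.val (h i j)⟩
    · rintro ⟨x, hx, h⟩
      exact hnr ⟨x, hx, fun i j hij => h (Subtype.ext hij)⟩

theorem step_mem {l k m : ℕ} (hl : 0 < l) (hm : m ∈ tSet l k) :
    ⌊2 * (m : ℝ) + ((l : ℝ) + 2 * Real.sqrt l) ^ k⌋₊ ∈ tSet l (k + 1) := by
  intro n hn r hr α c
  by_contra! h
  exact absurd (step_general hl hm hr c h.1 h.2) (not_le.2 ((Nat.floor_lt (by positivity)).1 hn))

theorem tSet_nonempty {l : ℕ} (hl : 0 < l) : ∀ k, (tSet l k).Nonempty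
  | 0 => ⟨0, fun _ hn _ _ _ _ => Or.inr ⟨fun _ => ⟨0, hn⟩, fun i => i.elim0, fun i => i.elim0⟩⟩
  | k + 1 => ⟨_, step_mem hl (tSet_nonempty hl k).some_mem⟩

/-- For all positive integers l and all k ≥ 2,
t(l,k) ≤ 2 · t(l,k-1) + (l + 2√l)^{k-1}. -/
theorem t_recursion (l k : ℕ) (hl : 0 < l) (hk : 2 ≤ k) :
    (t l k : ℝ) ≤ 2 * (t l (k - 1) : ℝ) + ((l : ℝ) + 2 * Real.sqrt l) ^ (k - 1) := by
  obtain ⟨k, rfl⟩ : ∃ j, k = j + 1 := ⟨k - 1, by omega⟩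
  rw [Nat.add_sub_cancel]
  have hm : t l k ∈ tSet l k := Nat.sInf_mem (tSet_nonempty hl k)
  have h1 : t l (k + 1) ≤ _ := Nat.sInf_le (step_mem hl hm)
  exact (Nat.cast_le.2 h1).trans (Nat.floor_le (by positivity))
end
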